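/- Let L be a q-linearized polynomial with coefficients in F_q, let n be a positive even integer, and let t be a positive integer with gcd(t, 2p) = 1. Assume that w_n is even and that w_{nd} = d·w_n for every divisor d of t. Then λ_{nd} = λ_n for every divisor d of t. -/

import Mathlib

/-- The radical of a quadratic form `Q`: the set of `x` with
`Q(x+y) - Q(x) - Q(y) = 0` for all `y`. -/
def radicalSet {K F : Type*} [CommRing K] [CommRing F] (Q : F → K) : Set F :=
  {x | ∀ y, Q (x + y) - Q x - Q y = 0}

/-- The map induced by the `q`-linearized polynomial `∑ i < N, c i * X ^ q ^ i`. -/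
def linPolyMap {K F : Type*} [CommSemiring K] [CommSemiring F] [Algebra K F]
    (q N : ℕ) (c : ℕ → K) (x : F) : F :=
  ∑ i ∈ Finset.range N, algebraMap K F (c i) * x ^ q ^ i

/-- The quadratic form `x ↦ Tr(x · L(x))` attached to the linearized polynomial
`∑ i < N, c i * X ^ q ^ i`. -/
noncomputable def traceForm {K : Type*} (F : Type*) [Field K] [Field F] [Algebra K F]
    (q N : ℕ) (c : ℕ → K) (x : F) : K :=
  Algebra.trace K F (x * linPolyMap q N c x)

theorem linPolyMap_algHom {K E M : Type*} [Field K] [Field E] [Field M] [Algebra K E]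
    [Algebra K M] (q N : ℕ) (c : ℕ → K) (φ : E →ₐ[K] M) (x : E) :
    linPolyMap q N c (φ x) = φ (linPolyMap q N c x) := by
  simp [linPolyMap]

theorem linPolyMap_smul {K F : Type*} [Field K] [Fintype K] [Field F] [Algebra K F]
    (N : ℕ) (c : ℕ → K) (a : K) (x : F) :
    linPolyMap (Fintype.card K) N c (a • x) = a • linPolyMap (Fintype.card K) N c x := by
  simp only [linPolyMap, Finset.smul_sum, smul_pow, FiniteField.pow_card_pow, mul_smul_comm]

theorem traceForm_smul {K F : Type*} [Field K] [Fintype K] [Field F] [Algebra K F]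
    (N : ℕ) (c : ℕ → K) (a : K) (x : F) :
    traceForm F (Fintype.card K) N c (a • x) = a ^ 2 * traceForm F (Fintype.card K) N c x := by
  rw [traceForm, linPolyMap_smul, smul_mul_smul_comm, map_smul, smul_eq_mul, traceForm, sq]

theorem traceForm_algEquiv {K F : Type*} [Field K] [Field F] [Algebra K F]
    (q N : ℕ) (c : ℕ → K) (σ : F ≃ₐ[K] F) (x : F) :
    traceForm F q N c (σ x) = traceForm F q N c x := by
  have h : linPolyMap q N c (σ x) = σ (linPolyMap q N c x) := linPolyMap_algHom q N c σ.toAlgHom x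
  rw [traceForm, h, ← map_mul, Algebra.trace_eq_of_algEquiv, traceForm]

theorem traceForm_algebraMap {K E M : Type*} [Field K] [Field E] [Field M] [Algebra K E]
    [Algebra K M] [Algebra E M] [IsScalarTower K E M] [FiniteDimensional K E]
    [FiniteDimensional E M] (q N : ℕ) (c : ℕ → K) (x : E) :
    traceForm M q N c (algebraMap E M x) = (Module.finrank E M : K) * traceForm E q N c x := by
  have h := linPolyMap_algHom q N c (IsScalarTower.toAlgHom K E M) x
  simp only [IsScalarTower.coe_toAlgHom'] at h
  rw [traceForm, h, ← map_mul, ← Algebra.trace_trace (S := E), Algebra.trace_algebraMap,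
    map_nsmul, nsmul_eq_mul, traceForm]

/-- The Galois group of an extension of prime degree acts on the level sets of the trace form,
and the fixed points are the points of a level set over the smaller field. -/
theorem card_level_modEq {K E M : Type*} [Field K] [Field E] [Field M] [Finite E] [Finite M]
    [Algebra K E] [Algebra K M] [Algebra E M] [IsScalarTower K E M] [FiniteDimensional K E]
    (q N : ℕ) (c : ℕ → K) {l : ℕ} [Fact l.Prime] (hl : Module.finrank E M = l)
    (hlK : (l : K) ≠ 0) (a : K) :
    Nat.card {x : M // traceForm M q N c x = a} ≡
      Nat.card {x : E // traceForm E q N c x = (l : K)⁻¹ * a} [MOD l] := by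
  let S : SubMulAction Gal(M/E) M :=
    { carrier := {x | traceForm M q N c x = a}
      smul_mem' := fun σ x hx => by
        simpa using (traceForm_algEquiv q N c (σ.restrictScalars K) x).trans hx }
  have hG : IsPGroup l Gal(M/E) := by
    refine IsPGroup.of_card (n := 1) ?_
    rw [IsGalois.card_aut_eq_finrank, hl, pow_one]
  have h := hG.card_modEq_card_fixedPoints S
  suffices hc : Nat.card {x : E // traceForm E q N c x = (l : K)⁻¹ * a} =
      Nat.card (MulAction.fixedPoints Gal(M/E) S) by rw [hc]; exact h
  have key : ∀ x : E, traceForm M q N c (algebraMap E M x) = a ↔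
      traceForm E q N c x = (l : K)⁻¹ * a := fun x => by
    rw [traceForm_algebraMap, hl, eq_inv_mul_iff_mul_eq₀ hlK]
  refine Nat.card_eq_of_bijective
    (fun x => ⟨⟨algebraMap E M x.1, (key x.1).2 x.2⟩, fun σ => Subtype.ext (σ.commutes x.1)⟩)
    ⟨fun x y hxy => ?_, fun y => ?_⟩
  · simpa [Subtype.ext_iff] using hxy
  · obtain ⟨⟨y, hy⟩, hfix⟩ := y
    obtain ⟨x, rfl⟩ := IntermediateField.mem_bot.1
      ((IsGalois.mem_bot_iff_fixed y).2 fun σ => congrArg Subtype.val (hfix σ))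
    exact ⟨⟨x, (key x).1 hy⟩, rfl⟩

theorem card_level_mul_sq {K V : Type*} [Field K] [AddCommGroup V] [Module K V]
    {Q : V → K} (hQ : ∀ (a : K) x, Q (a • x) = a ^ 2 * Q x) (a : K) {b : K} (hb : b ≠ 0) :
    Nat.card {x // Q x = a * b ^ 2} = Nat.card {x // Q x = a} := by
  refine (Nat.card_congr ((LinearEquiv.smulOfNeZero K V b hb).toEquiv.subtypeEquiv
    fun x => ?_)).symm
  simp [hQ, mul_comm, hb]

/-- For a form `Q` with `Q (a • x) = a ^ 2 * Q x`, the levels `a` and `g * a` together have the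
same size for all `a ≠ 0`, where `g` is a nonsquare. -/
theorem card_level_add_card_level {K V : Type*} [Field K] [Fintype K] [AddCommGroup V] [Module K V]
    [Finite V] {g : K} (hg : ¬IsSquare g)
    {Q : V → K} (hQ : ∀ (a : K) x, Q (a • x) = a ^ 2 * Q x) {a : K} (ha : a ≠ 0) :
    ((Fintype.card K : ℤ) - 1) * (Nat.card {x // Q x = a} + Nat.card {x // Q x = g * a}) =
      2 * (Nat.card V - Nat.card {x // Q x = 0}) := by
  classical
  have hg0 : g ≠ 0 := by rintro rfl; exact hg (IsSquare.zero)
  have hT : ∀ b : K, b ≠ 0 → Nat.card {x // Q x = b} + Nat.card {x // Q x = g * b} =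
      Nat.card {x // Q x = a} + Nat.card {x // Q x = g * a} := by
    intro b hb
    have hab : b / a ≠ 0 := div_ne_zero hb ha
    by_cases hs : IsSquare (b / a)
    · obtain ⟨r, hr⟩ := hs
      have hr0 : r ≠ 0 := by rintro rfl; simp at hr; tauto
      have hb' : b = a * r ^ 2 := by field_simp at hr; rw [hr]
      rw [hb', ← mul_assoc, card_level_mul_sq hQ _ hr0, card_level_mul_sq hQ _ hr0]
    · have hs' : IsSquare (b / a / g) := by
        rw [← quadraticChar_one_iff_isSquare (div_ne_zero hab hg0), div_eq_mul_inv _ g, map_mul,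
          quadraticChar_neg_one_iff_not_isSquare.2 hs,
          quadraticChar_neg_one_iff_not_isSquare.2 (by rwa [isSquare_inv])]
        norm_num
      obtain ⟨r, hr⟩ := hs'
      have hr0 : r ≠ 0 := by rintro rfl; simp at hr; tauto
      have hb' : b = g * a * r ^ 2 := by field_simp at hr; rw [hr]; ring
      have hgb : g * b = a * (g * r) ^ 2 := by rw [hb']; ring
      rw [hgb, hb', card_level_mul_sq hQ _ hr0, card_level_mul_sq hQ _ (mul_ne_zero hg0 hr0),
        add_comm]
  have hV : Nat.card V = ∑ b : K, Nat.card {x // Q x = b} := by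
    rw [← Nat.card_sigma]
    exact Nat.card_congr (Equiv.sigmaFiberEquiv Q).symm
  have hV' : Nat.card V = ∑ b : K, Nat.card {x // Q x = g * b} := by
    rw [hV]
    exact (Equiv.sum_comp (Equiv.mulLeft₀ g hg0) fun b => Nat.card {x // Q x = b}).symm
  have hsum : 2 * Nat.card V = 2 * Nat.card {x // Q x = 0} + (Fintype.card K - 1) *
      (Nat.card {x // Q x = a} + Nat.card {x // Q x = g * a}) := by
    rw [two_mul, ← Finset.card_univ, ← Finset.card_erase_of_mem (Finset.mem_univ (0 : K)),
      ← smul_eq_mul (Finset.card _), ← Finset.sum_const]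
    nth_rw 1 [hV]
    rw [hV', ← Finset.sum_add_distrib, ← Finset.add_sum_erase _ _ (Finset.mem_univ (0 : K)),
      mul_zero, ← two_mul]
    congr 1
    exact Finset.sum_congr rfl fun b hb => hT b (Finset.ne_of_mem_erase hb)
  have h1 : 1 ≤ Fintype.card K := Fintype.card_pos
  zify [h1] at hsum
  linarith

/-- The sizes of the levels `a` and `g * a` of the trace form, where `a ≠ 0` and `g` is a
nonsquare, in terms of the sign in the number of its zeros. -/
theorem card_mul_card_level_add {K V : Type*} [Field K] [Fintype K] [Field V] [Finite V]
    [Algebra K V] {g : K} (hg : ¬IsSquare g) (N : ℕ) (c : ℕ → K)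
    {k f : ℕ} {u : ℤ} (hk : 0 < k) (hf : 0 < f) (hV : Module.finrank K V = k)
    (hN : (Nat.card {x : V // traceForm V (Fintype.card K) N c x = 0} : ℤ) =
      Fintype.card K ^ (k - 1) + u * (Fintype.card K - 1) * Fintype.card K ^ (f - 1))
    {a : K} (ha : a ≠ 0) :
    (Fintype.card K : ℤ) * (Nat.card {x : V // traceForm V (Fintype.card K) N c x = a} +
      Nat.card {x : V // traceForm V (Fintype.card K) N c x = g * a}) =
    2 * (Fintype.card K ^ k - u * Fintype.card K ^ f) := by
  have h := card_level_add_card_level hg (traceForm_smul (F := V) N c) ha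
  have hc : Nat.card V = Fintype.card K ^ k := by
    rw [Module.natCard_eq_pow_finrank (K := K), hV, Nat.card_eq_fintype_card]
  have hq1 : (Fintype.card K : ℤ) - 1 ≠ 0 := by
    have := Fintype.one_lt_card (α := K)
    omega
  obtain ⟨k, rfl⟩ := Nat.exists_eq_add_of_lt hk
  obtain ⟨f, rfl⟩ := Nat.exists_eq_add_of_lt hf
  simp only [zero_add, Nat.add_sub_cancel] at hN hc ⊢
  rw [hN, hc] at h
  refine mul_left_cancel₀ hq1 ?_
  rw [mul_left_comm, h]
  push_cast
  ring

/-- The sign in the point count of the trace form is unchanged by an extension of odd prime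
degree `l` different from the characteristic, if `w` is multiplied by `l` as well. -/
theorem sign_eq_of_prime_degree {K E M : Type*} [Field K] [Fintype K] [Field E] [Field M]
    [Finite E] [Finite M] [Algebra K E] [Algebra K M] (hK : ringChar K ≠ 2)
    (N : ℕ) (c : ℕ → K) {l m e : ℕ} (hl : l.Prime) (hl2 : l ≠ 2) (hlK : (l : K) ≠ 0)
    (hlq : l.Coprime (Fintype.card K))
    (hm : 0 < m) (he : 0 < e) (hE : Module.finrank K E = m) (hM : Module.finrank K M = m * l)
    {s s' : ℤ} (hs : s = 1 ∨ s = 0 ∨ s = -1) (hs' : s' = 1 ∨ s' = 0 ∨ s' = -1)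
    (hNE : (Nat.card {x : E // traceForm E (Fintype.card K) N c x = 0} : ℤ) =
      Fintype.card K ^ (m - 1) + s * (Fintype.card K - 1) * Fintype.card K ^ (e - 1))
    (hNM : (Nat.card {x : M // traceForm M (Fintype.card K) N c x = 0} : ℤ) =
      Fintype.card K ^ (m * l - 1) + s' * (Fintype.card K - 1) * Fintype.card K ^ (e * l - 1)) :
    s' = s := by
  have : Fact l.Prime := ⟨hl⟩
  obtain ⟨φ⟩ : Nonempty (E →ₐ[K] M) :=
    FiniteField.nonempty_algHom_of_finrank_dvd (by rw [hE, hM]; exact dvd_mul_right _ _)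
  let _ : Algebra E M := φ.toRingHom.toAlgebra
  have : IsScalarTower K E M := .of_algebraMap_eq' φ.comp_algebraMap.symm
  have hEM : Module.finrank E M = l := by
    have := Module.finrank_mul_finrank K E M
    rw [hE, hM] at this
    exact Nat.eq_of_mul_eq_mul_left hm this
  obtain ⟨g, hg⟩ := FiniteField.exists_nonsquare hK
  have hlE : (l : K)⁻¹ ≠ 0 := inv_ne_zero hlK
  have h1 := card_mul_card_level_add hg N c hm he hE hNE hlE
  have h2 := card_mul_card_level_add hg N c (Nat.mul_pos hm hl.pos) (Nat.mul_pos he hl.pos) hM hNM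
    one_ne_zero
  have c1 := card_level_modEq (E := E) (M := M) (Fintype.card K) N c hEM hlK 1
  have c2 := card_level_modEq (E := E) (M := M) (Fintype.card K) N c hEM hlK (g * 1)
  rw [mul_one] at c1
  rw [mul_one, mul_comm _ g] at c2
  rw [mul_one] at h2
  rw [← ZMod.natCast_eq_natCast_iff] at c1 c2
  have h1' := congrArg (Int.cast : ℤ → ZMod l) h1
  have h2' := congrArg (Int.cast : ℤ → ZMod l) h2
  push_cast at h1' h2'
  rw [c1, c2, h1', pow_mul, pow_mul, ZMod.pow_card, ZMod.pow_card] at h2'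
  have hq0 : (Fintype.card K : ZMod l) ≠ 0 := by
    rw [Ne, ZMod.natCast_eq_zero_iff]
    exact (Nat.Prime.coprime_iff_not_dvd hl).1 hlq
  have h20 : (2 : ZMod l) ≠ 0 := by
    have : ((2 : ℕ) : ZMod l) ≠ 0 := by
      rw [Ne, ZMod.natCast_eq_zero_iff, Nat.prime_dvd_prime_iff_eq hl Nat.prime_two]
      exact hl2
    exact_mod_cast this
  have hss : (s' : ZMod l) = s := by
    have := mul_left_cancel₀ h20 h2'
    exact (mul_right_cancel₀ (pow_ne_zero e hq0) (sub_right_inj.1 this)).symm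
  have hdvd : (l : ℤ) ∣ s - s' := (ZMod.intCast_eq_intCast_iff_dvd_sub _ _ _).1 hss
  have hl3 : 3 ≤ l := by have := hl.two_le; omega
  have := Int.eq_zero_of_abs_lt_dvd hdvd (by rw [abs_lt]; omega)
  omega

/-- Let `n` be even, `t` with `gcd(t, 2p) = 1`. If `w_n` is even and `w_{nd} = d·w_n`
for every `d ∣ t`, then the signs satisfy `λ_{nd} = λ_n` for every `d ∣ t`.
Here `F d` plays the role of `F_{q^{nd}}`, `w d` of `w_{nd}` and `lam d` of `λ_{nd}`. -/
theorem sign_stable_under_odd_extensions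
    (p r : ℕ) (hp : p.Prime) (hodd : Odd p) (hr : 0 < r)
    (q : ℕ) (hq : q = p ^ r)
    (n t : ℕ) (hn : 0 < n) (hneven : Even n) (ht : 0 < t)
    (ht2p : Nat.gcd t (2 * p) = 1)
    (K : Type) [Field K] [Fintype K] (hcK : Fintype.card K = q)
    (F : ℕ → Type) [∀ d, Field (F d)] [∀ d, Fintype (F d)] [∀ d, Algebra K (F d)]
    (hcF : ∀ d, d ∣ t → Fintype.card (F d) = q ^ (n * d))
    (N : ℕ) (c : ℕ → K)
    (Qf : ∀ d, F d → K)
    (hQf : ∀ d x, Qf d x = Algebra.trace K (F d) (x * linPolyMap q N c x))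
    (w : ℕ → ℕ)
    (hw : ∀ d, w d = Module.finrank K (Submodule.span K (radicalSet (Qf d))))
    (lam : ℕ → ℤ)
    (hlam : ∀ d, d ∣ t → (lam d = 1 ∨ lam d = 0 ∨ lam d = -1) ∧
      ({x : F d | Qf d x = 0}.ncard : ℤ) =
        q ^ (n * d - 1) + lam d * (q - 1) * q ^ ((n * d + w d) / 2 - 1))
    (hwn : Even (w 1)) (hwd : ∀ d, d ∣ t → w d = d * w 1) :
    ∀ d, d ∣ t → lam d = lam 1 := by
  subst hcK
  have hQ : ∀ d, Qf d = traceForm (F d) (Fintype.card K) N c := fun d => funext (hQf d)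
  obtain ⟨ht2, htp⟩ := Nat.coprime_mul_iff_right.1 ht2p
  have : Fact p.Prime := ⟨hp⟩
  have : CharP K p := by
    obtain ⟨p', _, k, hp', hk⟩ := FiniteField.card' K
    rw [hq] at hk
    have hdvd : p ∣ p' ^ (k : ℕ) := hk ▸ dvd_pow_self p hr.ne'
    rwa [(Nat.prime_dvd_prime_iff_eq hp hp').1 (hp.dvd_of_dvd_pow hdvd)]
  have hK2 : ringChar K ≠ 2 := by
    rw [ringChar.eq K p]
    rintro rfl
    exact absurd hodd (by decide)
  have hrank : ∀ d, d ∣ t → Module.finrank K (F d) = n * d := fun d hd =>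
    Nat.pow_right_injective (Fintype.one_lt_card (α := K))
      ((Module.card_eq_pow_finrank (K := K) (V := F d)).symm.trans (hcF d hd))
  intro d
  induction d using induction_on_primes with
  | zero => intro h; exact absurd (Nat.eq_zero_of_zero_dvd h) ht.ne'
  | one => intro _; rfl
  | prime_mul l d hl ih =>
    intro hd
    have hdt : d ∣ t := (dvd_mul_left d l).trans hd
    have hlt : l ∣ t := (dvd_mul_right l d).trans hd
    have hd0 : 0 < d := Nat.pos_of_dvd_of_pos hdt ht
    have hlp : l.Coprime p := htp.coprime_dvd_left hlt
    rw [← ih hdt]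
    obtain ⟨a, rfl⟩ := hneven
    obtain ⟨b, hb⟩ := hwn
    have he : ((a + a) * d + w d) / 2 = (a + b) * d := by
      rw [hwd d hdt, hb, show (a + a) * d + d * (b + b) = 2 * ((a + b) * d) by ring]
      omega
    have he' : ((a + a) * (l * d) + w (l * d)) / 2 = (a + b) * d * l := by
      rw [hwd _ hd, hb,
        show (a + a) * (l * d) + l * d * (b + b) = 2 * ((a + b) * d * l) by ring]
      omega
    obtain ⟨hs, hN⟩ := hlam d hdt
    obtain ⟨hs', hN'⟩ := hlam _ hd
    rw [he, hQ] at hN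
    rw [he', hQ, show (a + a) * (l * d) = (a + a) * d * l by ring] at hN'
    refine sign_eq_of_prime_degree (E := F d) (M := F (l * d)) (l := l) (m := (a + a) * d)
      (e := (a + b) * d) hK2 N c hl ?_ ?_ ?_ (Nat.mul_pos hn hd0)
      (Nat.mul_pos (by omega) hd0) (hrank d hdt) ?_ hs hs' hN hN'
    · rintro rfl
      simpa using ht2.coprime_dvd_left hlt
    · rw [Ne, CharP.cast_eq_zero_iff K p]
      exact (Nat.Prime.coprime_iff_not_dvd hp).1 hlp.symm
    · rw [hq]; exact hlp.pow_right r
    · rw [hrank _ hd]; ring
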